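/- Suppose u : ℝ → ℝ is locally absolutely continuous with derivative u_x, F : ℝ → ℝ is nondecreasing with 0 ≤ F(x) ≤ F_∞ for all x ∈ ℝ, and ∫_a^b u_x(z)² dz ≤ F(b) − F(a) for all a ≤ b. Let u_p = P_{Δx}u be the piecewise linear projection of u on the grid of mesh Δx > 0. Then sup_{x ∈ ℝ} |u(x) − u_p(x)| ≤ √F_∞ · √Δx. -/

import Mathlib

open MeasureTheory intervalIntegral

/-- Piecewise linear projection on the grid of mesh `dx`: the unique function equal to
`f (j * dx)` at every grid point `j * dx` (`j ∈ ℤ`) and affine on each cell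
`[j * dx, (j+1) * dx]`. -/
noncomputable def plProj (dx : ℝ) (f : ℝ → ℝ) : ℝ → ℝ := fun x =>
  f ((⌊x / dx⌋ : ℝ) * dx) +
    ((x - (⌊x / dx⌋ : ℝ) * dx) / dx) *
      (f (((⌊x / dx⌋ : ℝ) + 1) * dx) - f ((⌊x / dx⌋ : ℝ) * dx))

/-- Cauchy-Schwarz on one interval. -/
lemma sq_integral_le_aux (f : ℝ → ℝ) (a b : ℝ) (hab : a ≤ b)
    (h1 : IntervalIntegrable f volume a b)
    (h2 : IntervalIntegrable (fun z => f z ^ 2) volume a b) :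
    (∫ z in a..b, f z) ^ 2 ≤ (b - a) * ∫ z in a..b, f z ^ 2 := by
  rcases hab.eq_or_lt with rfl | hlt
  · simp
  set m := ∫ z in a..b, f z with hm
  set S := ∫ z in a..b, f z ^ 2 with hS
  have h0 : 0 ≤ ∫ z in a..b, ((b - a) * f z - m) ^ 2 :=
    intervalIntegral.integral_nonneg hab (fun z _ => sq_nonneg _)
  have e : (∫ z in a..b, ((b - a) * f z - m) ^ 2)
      = (b - a) ^ 2 * S - (2 * (b - a) * m) * m + (b - a) * m ^ 2 := by
    have e1 : (fun z => ((b - a) * f z - m) ^ 2)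
        = fun z => ((b - a) ^ 2 * f z ^ 2 - (2 * (b - a) * m) * f z) + m ^ 2 := by
      funext z; ring
    rw [e1, intervalIntegral.integral_add ((h2.const_mul _).sub (h1.const_mul _))
      intervalIntegrable_const, intervalIntegral.integral_sub (h2.const_mul _) (h1.const_mul _),
      intervalIntegral.integral_const_mul, intervalIntegral.integral_const_mul,
      intervalIntegral.integral_const, smul_eq_mul]
  rw [e] at h0
  have h3 : 0 ≤ (b - a) * ((b - a) * S - m ^ 2) := by linarith
  have := nonneg_of_mul_nonneg_right h3 (sub_pos.2 hlt)
  linarith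

/-- First projection estimate: `‖u - P_{Δx} u‖_∞ ≤ √F_∞ √Δx`. -/
theorem projection_estimate_u_sup
    (u ux F : ℝ → ℝ) (Finf : ℝ) (hFinf : 0 < Finf)
    (hFmono : Monotone F)
    (hF0 : ∀ x, 0 ≤ F x) (hFle : ∀ x, F x ≤ Finf)
    (hux_int : ∀ a b : ℝ, IntervalIntegrable ux volume a b)
    (hux2_int : ∀ a b : ℝ, IntervalIntegrable (fun z => ux z ^ 2) volume a b)
    (hFTC : ∀ a b : ℝ, a ≤ b → u b - u a = ∫ z in a..b, ux z)
    (hE : ∀ a b : ℝ, a ≤ b → (∫ z in a..b, ux z ^ 2) ≤ F b - F a)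
    (dx : ℝ) (hdx : 0 < dx) :
    ∀ x : ℝ, |u x - plProj dx u x| ≤ Real.sqrt Finf * Real.sqrt dx := by
  have key : ∀ a b : ℝ, a ≤ b → b - a ≤ dx → |u b - u a| ≤ Real.sqrt Finf * Real.sqrt dx := by
    intro a b hab hd
    rw [← Real.sqrt_mul hFinf.le]
    apply Real.abs_le_sqrt
    have h1 := sq_integral_le_aux ux a b hab (hux_int a b) (hux2_int a b)
    rw [← hFTC a b hab] at h1
    have h2 : (∫ z in a..b, ux z ^ 2) ≤ Finf := by
      linarith [hE a b hab, hF0 a, hFle b]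
    have h3 : (b - a) * (∫ z in a..b, ux z ^ 2) ≤ (b - a) * Finf :=
      mul_le_mul_of_nonneg_left h2 (sub_nonneg.2 hab)
    have h4 : (b - a) * Finf ≤ dx * Finf := mul_le_mul_of_nonneg_right hd hFinf.le
    linarith
  intro x
  unfold plProj
  have ha : (⌊x / dx⌋ : ℝ) * dx ≤ x := (le_div_iff₀ hdx).1 (Int.floor_le _)
  have hb : x ≤ ((⌊x / dx⌋ : ℝ) + 1) * dx := (div_le_iff₀ hdx).1 (Int.lt_floor_add_one _).le
  have hw : ((⌊x / dx⌋ : ℝ) + 1) * dx = (⌊x / dx⌋ : ℝ) * dx + dx := by ring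
  have k1 := key _ _ ha (by linarith)
  have k2 := key _ _ hb (by linarith)
  have t0 : 0 ≤ (x - (⌊x / dx⌋ : ℝ) * dx) / dx := div_nonneg (by linarith) hdx.le
  have t1 : (x - (⌊x / dx⌋ : ℝ) * dx) / dx ≤ 1 := (div_le_one hdx).2 (by linarith)
  generalize (x - (⌊x / dx⌋ : ℝ) * dx) / dx = t at *
  generalize u (((⌊x / dx⌋ : ℝ) + 1) * dx) = B at *
  generalize u ((⌊x / dx⌋ : ℝ) * dx) = A at *
  generalize Real.sqrt Finf * Real.sqrt dx = C at *
  rw [abs_le] at *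
  constructor <;> nlinarith
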